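/- Let λ, μ be partitions and τ ≥ 0 an integer, and let B_0 be the bipartition whose top row is (μ_1 + τ, μ_2, μ_3, …) and whose bottom row is λ. Then (a) B_0 ∈ Θ^{+,τ}_0(λ, μ); and (b) for every pair of partitions (λ', μ') with ‖λ'‖ + ‖μ'‖ = ‖λ‖ + ‖μ‖ which is strictly smaller than (λ, μ) in the ε = + order — meaning ‖λ'‖ < ‖λ‖, or ‖λ'‖ = ‖λ‖ and λ' precedes λ lexicographically, or λ' = λ and μ' precedes μ lexicographically — the bipartition B_0 does not belong to Θ^{+,τ}_k(λ', μ') for any k ≥ 0. -/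

import Mathlib

/-- The weakly decreasing rearrangement of a weakly decreasing sequence `f`
with one extra part `t` inserted. -/
def insertPart (t : ℕ) (f : ℕ → ℕ) : ℕ → ℕ
  | 0 => max (f 0) t
  | n + 1 => max (min (f n) t) (f (n + 1))

/-- A partition: a weakly decreasing sequence of naturals with
finitely many nonzero terms. -/
def IsPartition (f : ℕ → ℕ) : Prop := Antitone f ∧ ∃ N, ∀ n, N ≤ n → f n = 0

/-- The size `‖f‖` of a partition: the sum of its parts. -/
noncomputable def psize (f : ℕ → ℕ) : ℕ := ∑ᶠ n, f n

/-- Membership of the bipartition `[M; L]` in `Θ^{+,τ}_k(λ,μ)`: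
`M_i ≥ μ_i ≥ M_{i+1}`, `λ_i ≥ L_i ≥ λ_{i+1}` for all `i`, with
`‖M‖ = ‖μ‖ + τ + k` and `‖L‖ = ‖λ‖ - k`.  (All sequences are 0-indexed.) -/
def ThetaPlusMem (τ k : ℕ) (lam mu M L : ℕ → ℕ) : Prop :=
  IsPartition M ∧ IsPartition L ∧
  (∀ i, mu i ≤ M i ∧ M (i + 1) ≤ mu i) ∧
  (∀ i, L i ≤ lam i ∧ lam (i + 1) ≤ L i) ∧
  psize M = psize mu + τ + k ∧ psize L + k = psize lam

/-- Membership of the bipartition `[M; L]` in `Θ^{-,τ}_k(λ,μ)`: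
`μ_i ≥ M_i ≥ μ_{i+1}`, `L_i ≥ λ_i ≥ L_{i+1}` for all `i`, with
`‖M‖ = ‖μ‖ - k` and `‖L‖ = ‖λ‖ + τ + k`.  (All sequences are 0-indexed.) -/
def ThetaMinusMem (τ k : ℕ) (lam mu M L : ℕ → ℕ) : Prop :=
  IsPartition M ∧ IsPartition L ∧
  (∀ i, M i ≤ mu i ∧ mu (i + 1) ≤ M i) ∧
  (∀ i, lam i ≤ L i ∧ L (i + 1) ≤ lam i) ∧
  psize M + k = psize mu ∧ psize L = psize lam + τ + k

/-- Lexicographic order on sequences: `f` strictly precedes `g`. -/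
def LexLt (f g : ℕ → ℕ) : Prop := ∃ i, (∀ j, j < i → f j = g j) ∧ f i < g i

theorem psize_eq_sum_range {f : ℕ → ℕ} {N : ℕ} (hf : ∀ n, N ≤ n → f n = 0) :
    psize f = ∑ n ∈ Finset.range N, f n := by
  refine finsum_eq_sum_of_support_subset f fun n hn => ?_
  by_contra h
  exact hn (hf n (by simpa using h))

theorem psize_lt_psize {f g : ℕ → ℕ} (hg : IsPartition g) (hle : ∀ n, f n ≤ g n)
    {i : ℕ} (hi : f i < g i) : psize f < psize g := by
  obtain ⟨N, hN⟩ := hg.2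
  rw [psize_eq_sum_range hN,
    psize_eq_sum_range fun n hn => Nat.le_zero.mp (hN n hn ▸ hle n)]
  refine Finset.sum_lt_sum (fun n _ => hle n) ⟨i, ?_, hi⟩
  by_contra h
  have := hN i (by simpa using h)
  omega

theorem psize_add_head {f : ℕ → ℕ} (hf : IsPartition f) (t : ℕ) :
    psize (fun n => if n = 0 then f 0 + t else f n) = psize f + t := by
  obtain ⟨N, hN⟩ := hf.2
  have hN' : ∀ n, N + 1 ≤ n → f n = 0 := fun n hn => hN n (by omega)
  rw [psize_eq_sum_range hN', psize_eq_sum_range (N := N + 1), Finset.sum_range_succ',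
    Finset.sum_range_succ']
  · simp [add_assoc]
  · intro n hn
    simpa [show n ≠ 0 by omega] using hN' n hn

theorem IsPartition.add_head {f : ℕ → ℕ} (hf : IsPartition f) (t : ℕ) :
    IsPartition (fun n => if n = 0 then f 0 + t else f n) := by
  obtain ⟨N, hN⟩ := hf.2
  refine ⟨antitone_nat_of_succ_le fun n => ?_, N + 1, fun n hn => ?_⟩
  · have := hf.1 (Nat.le_succ n)
    rcases n with _ | n
    · simpa using this.trans (Nat.le_add_right _ t)
    · simpa using this
  · simpa [show n ≠ 0 by omega] using hN n (by omega)

theorem not_lexLt_of_le {f g : ℕ → ℕ} (h : ∀ n, g n ≤ f n) : ¬ LexLt f g :=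
  fun ⟨i, _, hi⟩ => (h i).not_gt hi

/-- Lemma 0423, case ε = +: the bipartition `B₀` with top row
`(μ_1 + τ, μ_2, μ_3, …)` and bottom row `λ` lies in `Θ^{+,τ}_0(λ,μ)`, and it
lies in no `Θ^{+,τ}_k(λ',μ')` for any pair `(λ',μ')` of the same total size
which is smaller than `(λ,μ)` in the ε = + linear order. -/
theorem stmt9 (τ : ℕ) (lam mu : ℕ → ℕ)
    (hlam : IsPartition lam) (hmu : IsPartition mu)
    (M₀ L₀ : ℕ → ℕ)
    (hM₀ : M₀ = fun n => if n = 0 then mu 0 + τ else mu n)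
    (hL₀ : L₀ = lam) :
    ThetaPlusMem τ 0 lam mu M₀ L₀ ∧
    ∀ lam' mu' : ℕ → ℕ, IsPartition lam' → IsPartition mu' →
      psize lam' + psize mu' = psize lam + psize mu →
      (psize lam' < psize lam ∨
        (psize lam' = psize lam ∧ LexLt lam' lam) ∨
        (lam' = lam ∧ LexLt mu' mu)) →
      ∀ k : ℕ, ¬ ThetaPlusMem τ k lam' mu' M₀ L₀ := by
  subst hM₀ hL₀
  refine ⟨⟨hmu.add_head τ, hlam, fun i => ⟨?_, ?_⟩,
    fun i => ⟨le_rfl, hlam.1 (Nat.le_succ i)⟩, psize_add_head hmu τ, rfl⟩, ?_⟩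
  · rcases i with _ | i <;> simp
  · simpa using hmu.1 (Nat.le_succ i)
  rintro lam' mu' - - hsize hlt k ⟨-, -, hM, hL, hMsize, hLsize⟩
  rw [psize_add_head hmu τ] at hMsize
  rcases hlt with hlt | ⟨-, hlt⟩ | ⟨rfl, i, heq, hi⟩
  · omega
  · exact not_lexLt_of_le (fun n => (hL n).1) hlt
  · have hle : ∀ n, mu' n ≤ mu n := by
      rintro (_ | n)
      · rcases i with _ | i
        · exact hi.le
        · exact (heq 0 (Nat.succ_pos i)).le
      · simpa using (hM (n + 1)).1
    have := psize_lt_psize hmu hle hi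
    omega
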